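/- arXiv:1002.4711 — 2 statements merged into one kernel-verified Lean document; each statement's English description precedes it below -/
import Mathlib

section
/- Let A be a C*-algebra acting on a Hilbert space H. Then there exist unique C*-subalgebras A_I, A_II, A_III of A such that: (a) A_I is a C*-algebra of von Neumann type I, neither A_II nor A_III contains a nonzero Abelian annihilator, the lattice 𝒫_{A_II} is locally modular, and the lattice 𝒫_{A_III} is purely nonmodular; (b) A_I, A_II, A_III are central annihilators of A; (c) A_I ⊕ A_II ⊕ A_III is a C*-subalgebra of A and Ann(A_I ⊕ A_II ⊕ A_III) = {0}. -/
variable {A : Type*}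

/-- The annihilator of a set `S`: elements anticommuting with every member of `S`. -/
def Ann [NonUnitalNonAssocRing A] (S : Set A) : Set A :=
  {a : A | ∀ s ∈ S, a * s + s * a = 0}

/-- `ᵈV = {a ∈ A : x a y + y a x = 0 for all x, y ∈ V}`. -/
def dAnn [NonUnitalNonAssocRing A] (V : Set A) : Set A :=
  {a : A | ∀ x ∈ V, ∀ y ∈ V, x * a * y + y * a * x = 0}

/-- The relative annihilator of `S` in `B`. -/
def AnnIn [NonUnitalNonAssocRing A] (B S : Set A) : Set A :=
  {a ∈ B | ∀ s ∈ S, a * s + s * a = 0}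

/-- The relative `ᵈ`-set of `V` in `B`. -/
def dAnnIn [NonUnitalNonAssocRing A] (B V : Set A) : Set A :=
  {a ∈ B | ∀ x ∈ V, ∀ y ∈ V, x * a * y + y * a * x = 0}

/-- The set `𝒫` of annihilators of `A`. -/
def PAnn (A : Type*) [NonUnitalNonAssocRing A] [PartialOrder A] : Set (Set A) :=
  {V | ∃ S : Set A, (∀ s ∈ S, 0 ≤ s) ∧ V = Ann (Ann S)}

/-- The set `𝒫_B` of relative annihilators in `B`. -/
def PAnnIn [NonUnitalNonAssocRing A] [PartialOrder A] (B : Set A) : Set (Set A) :=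
  {V | ∃ S : Set A, S ⊆ B ∧ (∀ s ∈ S, 0 ≤ s) ∧ V = AnnIn B (AnnIn B S)}

/-- A central annihilator of `A`. -/
def IsCentralAnn [NonUnitalNonAssocRing A] [PartialOrder A] (V : Set A) : Prop :=
  ∃ S : Set A, (∀ s ∈ S, 0 ≤ s) ∧ V = Ann (Ann S) ∧
    dAnn (Ann (Ann S)) ∩ dAnn (Ann S) = {0}

/-- A central annihilator of the subalgebra `B`. -/
def IsCentralAnnIn [NonUnitalNonAssocRing A] [PartialOrder A] (B V : Set A) : Prop :=
  ∃ S : Set A, S ⊆ B ∧ (∀ s ∈ S, 0 ≤ s) ∧ V = AnnIn B (AnnIn B S) ∧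
    dAnnIn B (AnnIn B (AnnIn B S)) ∩ dAnnIn B (AnnIn B S) = {0}

/-- An Abelian annihilator of the subalgebra `B`: a commutative member of `𝒫_B`. -/
def IsAbelianAnnIn [NonUnitalNonAssocRing A] [PartialOrder A] (B V : Set A) : Prop :=
  V ∈ PAnnIn B ∧ ∀ x ∈ V, ∀ y ∈ V, x * y = y * x

/-- `C` is the central support of `V` in `B`: the least central annihilator of `B`
containing `V`. -/
def IsCentralSupportIn [NonUnitalNonAssocRing A] [PartialOrder A] (B V C : Set A) : Prop :=
  IsCentralAnnIn B C ∧ V ⊆ C ∧ ∀ W, IsCentralAnnIn B W → V ⊆ W → C ⊆ W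

/-- `B` is a C*-algebra of von Neumann type I: some Abelian annihilator of `B` has central
support `B`. -/
def VonNeumannTypeI [NonUnitalNonAssocRing A] [PartialOrder A] (B : Set A) : Prop :=
  ∃ V, IsAbelianAnnIn B V ∧ IsCentralSupportIn B V B

/-- `V` is the least upper bound of the family `T` within the collection `P` (ordered by `⊆`). -/
def IsLUBIn {α : Type*} (P T : Set (Set α)) (V : Set α) : Prop :=
  V ∈ P ∧ (∀ W ∈ T, W ⊆ V) ∧ ∀ U ∈ P, (∀ W ∈ T, W ⊆ U) → V ⊆ U

/-- `V` is the greatest lower bound of the family `T` within the collection `P`. -/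
def IsGLBIn {α : Type*} (P T : Set (Set α)) (V : Set α) : Prop :=
  V ∈ P ∧ (∀ W ∈ T, V ⊆ W) ∧ ∀ U ∈ P, (∀ W ∈ T, U ⊆ W) → U ⊆ V

/-- The collection `P` of sets is a modular lattice (with respect to inclusion). -/
def ModularLat {α : Type*} (P : Set (Set α)) : Prop :=
  ∀ X ∈ P, ∀ Y ∈ P, ∀ Z ∈ P, X ⊆ Z →
    ∀ m r₁ j r₂ : Set α, IsGLBIn P {Y, Z} m → IsLUBIn P {X, m} r₁ →
      IsLUBIn P {X, Y} j → IsGLBIn P {j, Z} r₂ → r₁ = r₂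

/-- Two sets are orthogonal if their pointwise products vanish. -/
def OrthogSets [Mul A] [Zero A] (V W : Set A) : Prop :=
  ∀ v ∈ V, ∀ w ∈ W, v * w = 0

/-- The lattice of annihilators of `B` is locally modular: there is a family of modular
annihilators of `B` with pairwise orthogonal central supports whose supremum is `B`. -/
def LocallyModular [NonUnitalNonAssocRing A] [PartialOrder A] (B : Set A) : Prop :=
  ∃ (T : Set (Set A)) (Z : Set A → Set A),
    (∀ V ∈ T, V ∈ PAnnIn B ∧ ModularLat (PAnnIn V)) ∧
    (∀ V ∈ T, IsCentralSupportIn B V (Z V)) ∧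
    (∀ V ∈ T, ∀ W ∈ T, V ≠ W → OrthogSets (Z V) (Z W)) ∧
    IsLUBIn (PAnnIn B) (Z '' T) B

/-- The lattice of annihilators of `B` is purely nonmodular: `B` has no nonzero modular
annihilator. -/
def PurelyNonmodular [NonUnitalNonAssocRing A] [PartialOrder A] (B : Set A) : Prop :=
  ∀ V ∈ PAnnIn B, ModularLat (PAnnIn V) → V = {0}

section CStar
variable [NonUnitalCStarAlgebra A] [PartialOrder A] [StarOrderedRing A]

/-- The conjunction of conditions (a), (b), (c) of Theorem 21 for a triple `(A_I, A_II, A_III)`. -/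
def TypeDecomposition (AI AII AIII : Set A) : Prop :=
  -- (a)
  VonNeumannTypeI AI ∧
  (∀ V, IsAbelianAnnIn AII V → V = {0}) ∧
  (∀ V, IsAbelianAnnIn AIII V → V = {0}) ∧
  LocallyModular AII ∧
  PurelyNonmodular AIII ∧
  -- (b)
  IsCentralAnn AI ∧ IsCentralAnn AII ∧ IsCentralAnn AIII ∧
  -- (c)
  (∃ B : NonUnitalStarSubalgebra ℂ A,
    (B : Set A) = {x : A | ∃ a ∈ AI, ∃ b ∈ AII, ∃ c ∈ AIII, x = a + b + c}) ∧
  IsClosed {x : A | ∃ a ∈ AI, ∃ b ∈ AII, ∃ c ∈ AIII, x = a + b + c} ∧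
  Ann {x : A | ∃ a ∈ AI, ∃ b ∈ AII, ∃ c ∈ AIII, x = a + b + c} = {0}

end CStar

namespace TypeDecomp

variable [NonUnitalCStarAlgebra A]

section Cancellation

theorem eq_zero_of_star_mul_self {x : A} (h : star x * x = 0) : x = 0 :=
  (CStarRing.star_mul_self_eq_zero_iff x).1 h

theorem eq_zero_of_mul_star_self {x : A} (h : x * star x = 0) : x = 0 :=
  (CStarRing.mul_star_self_eq_zero_iff x).1 h

theorem mul_eq_zero_of_star_mul {x y : A} (h : star x * (x * y) = 0) : x * y = 0 := by
  apply eq_zero_of_star_mul_self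
  rw [star_mul, mul_assoc, h, mul_zero]

theorem mul_eq_zero_of_mul_star {x y : A} (h : y * x * star x = 0) : y * x = 0 := by
  apply eq_zero_of_mul_star_self
  rw [star_mul, ← mul_assoc, h, zero_mul]

theorem eq_zero_of_add_self {x : A} (h : x + x = 0) : x = 0 := by
  rw [← two_smul ℂ x] at h
  exact (smul_eq_zero.1 h).resolve_left two_ne_zero

end Cancellation

/-- A self-adjoint additive subgroup `B` with `B A B ⊆ B` and `B B ⊆ B`. -/
structure IsHereditary (B : Set A) : Prop where
  zero : (0 : A) ∈ B
  add : ∀ {x y}, x ∈ B → y ∈ B → x + y ∈ B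
  neg : ∀ {x}, x ∈ B → -x ∈ B
  star : ∀ {x}, x ∈ B → star x ∈ B
  mul : ∀ {x y}, x ∈ B → y ∈ B → x * y ∈ B
  sandwich : ∀ {x y} (a : A), x ∈ B → y ∈ B → x * a * y ∈ B

/-- Self-adjoint sets. -/
def StarClosed (S : Set A) : Prop := ∀ x ∈ S, star x ∈ S

theorem IsHereditary.starClosed {B : Set A} (hB : IsHereditary B) : StarClosed B :=
  fun _ => hB.star

theorem IsHereditary.univ : IsHereditary (Set.univ : Set A) := by
  constructor <;> intros <;> trivial

/-- Elements of `B` whose two-sided products with `S` vanish. -/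
def perp (B S : Set A) : Set A := {a ∈ B | ∀ s ∈ S, a * s = 0 ∧ s * a = 0}

section Perp

variable {B S T : Set A}

theorem perp_subset : perp B S ⊆ B := fun _ h => h.1

theorem perp_anti (h : S ⊆ T) : perp B T ⊆ perp B S :=
  fun _ ha => ⟨ha.1, fun s hs => ha.2 s (h hs)⟩

theorem subset_perp_perp (h : S ⊆ B) : S ⊆ perp B (perp B S) :=
  fun _ hs => ⟨h hs, fun _ ha => (ha.2 _ hs).symm⟩

theorem perp_perp_perp (h : S ⊆ B) : perp B (perp B (perp B S)) = perp B S :=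
  (perp_anti (subset_perp_perp h)).antisymm (subset_perp_perp perp_subset)

theorem IsHereditary.perp (hB : IsHereditary B) (hS : StarClosed S) :
    IsHereditary (perp B S) where
  zero := ⟨hB.zero, by simp⟩
  add hx hy := ⟨hB.add hx.1 hy.1, fun s hs => by
    simp [add_mul, mul_add, hx.2 s hs, hy.2 s hs]⟩
  neg hx := ⟨hB.neg hx.1, fun s hs => by simp [hx.2 s hs]⟩
  star {x} hx := ⟨hB.star hx.1, fun s hs => by
    have h := hx.2 _ (hS s hs)
    constructor
    · apply star_injective; simpa using h.2
    · apply star_injective; simpa using h.1⟩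
  mul hx hy := ⟨hB.mul hx.1 hy.1, fun s hs => by
    rw [mul_assoc, (hy.2 s hs).1, ← mul_assoc, (hx.2 s hs).2]; simp⟩
  sandwich {x y} a hx hy := ⟨hB.sandwich a hx.1 hy.1, fun s hs => by
    refine ⟨?_, ?_⟩
    · rw [mul_assoc, (hy.2 s hs).1, mul_zero]
    · rw [← mul_assoc, ← mul_assoc, (hx.2 s hs).2, zero_mul, zero_mul]⟩

theorem eq_zero_of_mem_perp (hS : StarClosed S) {x : A} (hx : x ∈ S) (h : x ∈ perp B S) :
    x = 0 :=
  eq_zero_of_mul_star_self (h.2 _ (hS x hx)).1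

theorem annIn_eq_perp (hS : StarClosed S) (hm : ∀ x ∈ S, ∀ y ∈ S, x * y ∈ S) :
    AnnIn B S = perp B S := by
  ext a
  refine ⟨fun h => ⟨h.1, fun s hs => ?_⟩, fun h => ⟨h.1, fun s hs => by simp [h.2 s hs]⟩⟩
  have key : ∀ c ∈ S, star c * a = 0 := by
    intro c hc
    have h1 : a * c = -(c * a) := eq_neg_of_add_eq_zero_left (h.2 c hc)
    have h2 : a * star c = -(star c * a) := eq_neg_of_add_eq_zero_left (h.2 _ (hS c hc))
    have h3 := h.2 _ (hm c hc _ (hS c hc))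
    have h4 : a * (c * star c) = c * star c * a := by
      rw [← mul_assoc, h1, neg_mul, mul_assoc, h2, mul_neg, neg_neg, mul_assoc]
    rw [h4] at h3
    apply mul_eq_zero_of_star_mul
    rw [star_star, ← mul_assoc]
    exact eq_zero_of_add_self h3
  have h1 : s * a = 0 := by simpa using key _ (hS s hs)
  have h2 := h.2 s hs
  rw [h1, add_zero] at h2
  exact ⟨h2, h1⟩

theorem annIn_eq_perp_of_isHereditary (hS : IsHereditary S) : AnnIn B S = perp B S :=
  annIn_eq_perp hS.starClosed fun _ hx _ hy => hS.mul hx hy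

theorem annIn_univ (S : Set A) : AnnIn Set.univ S = Ann S := by
  ext; simp [AnnIn, Ann]

theorem dAnnIn_univ (S : Set A) : dAnnIn Set.univ S = dAnn S := by
  ext; simp [dAnnIn, dAnn]

/-- `E` absorbs multiplication by `B` on both sides. -/
def Absorbs (B E : Set A) : Prop := ∀ x ∈ E, ∀ b ∈ B, x * b ∈ E ∧ b * x ∈ E

theorem Absorbs.perp {E : Set A} (hB : IsHereditary B) (hE : Absorbs B E) :
    Absorbs B (perp B E) := fun x hx b hb =>
  ⟨⟨hB.mul hx.1 hb, fun e he => by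
      rw [mul_assoc, (hx.2 _ (hE e he b hb).2).1, ← mul_assoc, (hx.2 e he).2, zero_mul]; simp⟩,
    ⟨hB.mul hb hx.1, fun e he => by
      rw [mul_assoc, (hx.2 e he).1, ← mul_assoc, (hx.2 _ (hE e he b hb).1).2, mul_zero]; simp⟩⟩

theorem dAnnIn_eq {W : Set A} (hW : IsHereditary W) :
    dAnnIn B W = {a ∈ B | ∀ x ∈ W, ∀ y ∈ W, x * a * y = 0} := by
  ext a
  refine ⟨fun h => ⟨h.1, fun x hx y hy => ?_⟩, fun h => ⟨h.1, fun x hx y hy => ?_⟩⟩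
  · have hsq : ∀ z ∈ W, z * a * z = 0 := fun z hz => eq_zero_of_add_self (h.2 z hz z hz)
    have hw : x * a * y ∈ W := hW.sandwich a hx hy
    set c := star (x * a * y)
    have hv : y * c * y ∈ W := hW.sandwich c hy hy
    have h1 : x * a * y = -(y * a * x) := eq_neg_of_add_eq_zero_left (h.2 x hx y hy)
    have h2 : x * a * (y * c * y) = -((y * c * y) * a * x) :=
      eq_neg_of_add_eq_zero_left (h.2 x hx _ hv)
    have h3 : x * a * y * c * (x * a * y) = 0 := by
      calc x * a * y * c * (x * a * y) = x * a * y * c * (-(y * a * x)) := by rw [← h1]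
        _ = -(x * a * (y * c * y) * a * x) := by simp only [mul_neg, mul_assoc]
        _ = -(x * a * (y * c * y * a * x)) := by simp only [mul_assoc]
        _ = x * a * (x * a * (y * c * y)) := by rw [h2]; simp only [mul_neg]
        _ = x * a * x * a * (y * c * y) := by simp only [mul_assoc]
        _ = 0 := by rw [hsq x hx]; simp
    apply eq_zero_of_mul_star_self
    apply eq_zero_of_mul_star_self
    have h4 : x * a * y * c * star (x * a * y * c) = (x * a * y * c * (x * a * y)) * c := by
      simp only [c, star_mul, star_star, mul_assoc]
    exact h4.trans (by rw [h3, zero_mul])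
  · rw [h.2 x hx y hy, h.2 y hy x hx, add_zero]

end Perp

section Order

variable [PartialOrder A] [StarOrderedRing A]

theorem mul_eq_zero_of_anticommute {a s : A} (hs : 0 ≤ s) (h : a * s + s * a = 0) :
    a * s = 0 ∧ s * a = 0 := by
  have h1 : a * s = -(s * a) := eq_neg_of_add_eq_zero_left h
  have h2 : Commute (s * s) a := by
    change s * s * a = a * (s * s)
    rw [← mul_assoc a, h1, neg_mul, mul_assoc s a, h1, mul_neg, neg_neg, mul_assoc]
  have h3 : Commute s a := by
    rw [← CFC.sqrt_mul_self s hs]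
    exact h2.cfcₙ_nnreal _
  have h4 : s * a = 0 := by
    rw [← h3.eq] at h
    exact eq_zero_of_add_self h
  exact ⟨h3.eq ▸ h4, h4⟩

theorem annIn_eq_perp_of_nonneg {B S : Set A} (hS : ∀ s ∈ S, 0 ≤ s) :
    AnnIn B S = perp B S := by
  ext a
  exact ⟨fun h => ⟨h.1, fun s hs => mul_eq_zero_of_anticommute (hS s hs) (h.2 s hs)⟩,
    fun h => ⟨h.1, fun s hs => by simp [h.2 s hs]⟩⟩

theorem starClosed_of_nonneg {S : Set A} (hS : ∀ s ∈ S, 0 ≤ s) : StarClosed S :=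
  fun s hs => by
    rwa [(IsSelfAdjoint.of_nonneg (hS s hs)).star_eq]

theorem annIn_annIn_eq {B S : Set A} (hB : IsHereditary B) (hS : ∀ s ∈ S, 0 ≤ s) :
    AnnIn B (AnnIn B S) = perp B (perp B S) := by
  rw [annIn_eq_perp_of_nonneg hS,
    annIn_eq_perp_of_isHereditary (hB.perp (starClosed_of_nonneg hS))]

variable {B : Set A}

theorem mem_PAnnIn_iff (hB : IsHereditary B) {V : Set A} :
    V ∈ PAnnIn B ↔ StarClosed V ∧ perp B (perp B V) = V := by
  constructor
  · rintro ⟨S, hSB, hS, rfl⟩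
    rw [annIn_annIn_eq hB hS]
    exact ⟨(hB.perp (hB.perp (starClosed_of_nonneg hS)).starClosed).starClosed,
      perp_perp_perp perp_subset⟩
  · rintro ⟨hV, h⟩
    have hVB : V ⊆ B := h ▸ perp_subset
    have hS : ∀ s ∈ {s : A | ∃ v ∈ V, s = star v * v}, 0 ≤ s := by
      rintro _ ⟨v, -, rfl⟩
      exact star_mul_self_nonneg v
    refine ⟨{s | ∃ v ∈ V, s = star v * v}, ?_, hS, ?_⟩
    · rintro _ ⟨v, hv, rfl⟩
      exact hB.mul (hB.star (hVB hv)) (hVB hv)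
    · rw [annIn_annIn_eq hB hS]
      have : perp B {s | ∃ v ∈ V, s = star v * v} = perp B V := by
        ext a
        refine ⟨fun ha => ⟨ha.1, fun v hv => ⟨?_, ?_⟩⟩, fun ha => ⟨ha.1, ?_⟩⟩
        · apply mul_eq_zero_of_mul_star
          have := (ha.2 _ ⟨_, hV v hv, rfl⟩).1
          simpa [mul_assoc] using this
        · apply mul_eq_zero_of_star_mul
          have := (ha.2 _ ⟨_, hv, rfl⟩).2
          simpa [mul_assoc] using this
        · rintro _ ⟨v, hv, rfl⟩
          rw [mul_assoc, (ha.2 v hv).2, ← mul_assoc, (ha.2 _ (hV v hv)).1]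
          simp
      rw [this, h]

theorem perp_mem_PAnnIn (hB : IsHereditary B) {S : Set A} (hS : StarClosed S) (hSB : S ⊆ B) :
    perp B S ∈ PAnnIn B :=
  (mem_PAnnIn_iff hB).2 ⟨(hB.perp hS).starClosed, perp_perp_perp hSB⟩

theorem isHereditary_of_mem (hB : IsHereditary B) {V : Set A} (hV : V ∈ PAnnIn B) :
    IsHereditary V := by
  obtain ⟨h1, h2⟩ := (mem_PAnnIn_iff hB).1 hV
  rw [← h2]
  exact hB.perp (hB.perp h1).starClosed

theorem subset_of_mem (hB : IsHereditary B) {V : Set A} (hV : V ∈ PAnnIn B) : V ⊆ B :=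
  ((mem_PAnnIn_iff hB).1 hV).2 ▸ perp_subset

theorem self_mem_PAnnIn (hB : IsHereditary B) : B ∈ PAnnIn B :=
  (mem_PAnnIn_iff hB).2 ⟨hB.starClosed,
    perp_subset.antisymm (subset_perp_perp subset_rfl)⟩

theorem sInter_inter_mem_PAnnIn (hB : IsHereditary B) {F : Set (Set A)}
    (hF : ∀ V ∈ F, V ∈ PAnnIn B) : B ∩ ⋂₀ F ∈ PAnnIn B := by
  refine (mem_PAnnIn_iff hB).2 ⟨fun x hx => ⟨hB.star hx.1, fun V hV =>
    (isHereditary_of_mem hB (hF V hV)).star (hx.2 V hV)⟩,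
    Set.Subset.antisymm (fun x hx => ⟨hx.1, fun V hV => ?_⟩)
      (subset_perp_perp Set.inter_subset_left)⟩
  rw [← ((mem_PAnnIn_iff hB).1 (hF V hV)).2]
  exact perp_anti (perp_anti fun y hy => hy.2 V hV) hx

theorem inter_mem_PAnnIn (hB : IsHereditary B) {V W : Set A}
    (hV : V ∈ PAnnIn B) (hW : W ∈ PAnnIn B) : V ∩ W ∈ PAnnIn B := by
  have h := sInter_inter_mem_PAnnIn hB (F := {V, W}) (by simp [hV, hW])
  rwa [Set.sInter_pair, Set.inter_eq_right.2
    (Set.inter_subset_left.trans (subset_of_mem hB hV))] at h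

theorem isCentralAnnIn_iff (hB : IsHereditary B) {W : Set A} :
    IsCentralAnnIn B W ↔ W ∈ PAnnIn B ∧ Absorbs B W := by
  have key : ∀ W ∈ PAnnIn B, dAnnIn B W ∩ dAnnIn B (perp B W) = {0} ↔ Absorbs B W := by
    intro W hW
    have hWH := isHereditary_of_mem hB hW
    have hWB := subset_of_mem hB hW
    have hP := hB.perp hWH.starClosed
    have hWW := ((mem_PAnnIn_iff hB).1 hW).2
    rw [dAnnIn_eq hWH, dAnnIn_eq hP]
    constructor
    · intro h
      have h1 : ∀ x ∈ W, ∀ b ∈ B, x * b ∈ W := by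
        intro x hx b hb
        rw [← hWW]
        refine ⟨hB.mul (hWB hx) hb, fun w hw => ⟨?_, ?_⟩⟩
        · have : x * b * w ∈ ({0} : Set A) := by
            rw [← h]
            have hm : x * b * w ∈ B := hB.sandwich b (hWB hx) hw.1
            refine ⟨⟨hm, fun y _ z hz => ?_⟩, ⟨hm, fun y hy z _ => ?_⟩⟩
            · rw [mul_assoc y, mul_assoc _ w, (hw.2 z hz).1]; simp
            · rw [mul_assoc x, ← mul_assoc y x, (hy.2 x hx).1]; simp
          exact this
        · rw [← mul_assoc, (hw.2 x hx).1, zero_mul]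
      refine fun x hx b hb => ⟨h1 x hx b hb, ?_⟩
      simpa using hWH.star (h1 _ (hWH.star hx) _ (hB.star hb))
    · intro h
      refine Set.Subset.antisymm (fun a ⟨ha, ha'⟩ => ?_) ?_
      · have haW : a ∈ perp B W := by
          refine ⟨ha.1, fun v hv => ⟨?_, ?_⟩⟩
          · apply eq_zero_of_star_mul_self
            have := ha.2 _ (hWH.star (h v hv a ha.1).2) v hv
            rwa [mul_assoc] at this
          · apply eq_zero_of_mul_star_self
            exact ha.2 v hv _ (hWH.star (h v hv a ha.1).1)
        have h2 := ha'.2 _ (hP.star haW) _ (hP.star haW)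
        apply eq_zero_of_star_mul_self
        apply eq_zero_of_mul_star_self
        rw [star_mul, star_star, ← mul_assoc, h2, zero_mul]
      · rintro _ rfl
        exact ⟨⟨hB.zero, by simp⟩, ⟨hB.zero, by simp⟩⟩
  constructor
  · rintro ⟨S, hSB, hS, hW, h⟩
    have hWP : W ∈ PAnnIn B := ⟨S, hSB, hS, hW⟩
    refine ⟨hWP, (key W hWP).1 ?_⟩
    rw [← hW] at h
    rwa [hW, annIn_annIn_eq hB hS, perp_perp_perp hSB, ← annIn_eq_perp_of_nonneg hS,
      annIn_eq_perp_of_nonneg hS, ← annIn_annIn_eq hB hS, ← hW, ← annIn_eq_perp_of_nonneg hS]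
  · rintro ⟨hW, h⟩
    obtain ⟨S, hSB, hS, hW'⟩ := id hW
    refine ⟨S, hSB, hS, hW', ?_⟩
    have := (key W hW).2 h
    rw [hW'] at this
    rw [annIn_annIn_eq hB hS, perp_perp_perp hSB] at this
    rwa [annIn_annIn_eq hB hS, annIn_eq_perp_of_nonneg hS]

end Order

section Univ

theorem subset_perp_comm {S T : Set A} (h : S ⊆ perp Set.univ T) : T ⊆ perp Set.univ S :=
  fun t ht => ⟨trivial, fun _ hs => ((h hs).2 t ht).symm⟩

theorem subset_perp_of_inter {V D : Set A} (hV : IsHereditary V) (hD : Absorbs Set.univ D)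
    (hDs : StarClosed D) (h : V ∩ D ⊆ {0}) : V ⊆ perp Set.univ D := by
  have key : ∀ x ∈ V, ∀ d ∈ D, x * d = 0 := by
    intro x hx d hd
    apply eq_zero_of_mul_star_self
    have h1 : x * (d * star d) * star x ∈ V := hV.sandwich _ hx (hV.star hx)
    have h2 : x * (d * star d) * star x ∈ D :=
      (hD _ (hD _ (hD d hd _ trivial).1 x trivial).2 _ trivial).1
    have h3 : x * (d * star d) * star x = 0 := h ⟨h1, h2⟩
    simpa [mul_assoc] using h3
  refine fun x hx => ⟨trivial, fun d hd => ⟨key x hx d hd, ?_⟩⟩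
  apply star_injective
  simpa using key _ (hV.star hx) _ (hDs d hd)

/-- The annihilator generated by a commutative hereditary set is commutative. -/
theorem commute_perp_perp {U : Set A} (hU : IsHereditary U)
    (hc : ∀ x ∈ U, ∀ y ∈ U, x * y = y * x) :
    ∀ x ∈ perp Set.univ (perp Set.univ U), ∀ y ∈ perp Set.univ (perp Set.univ U),
      x * y = y * x := by
  have hP := IsHereditary.univ.perp hU.starClosed
  have hW := IsHereditary.univ.perp hP.starClosed
  set W := perp Set.univ (perp Set.univ U)
  have hUW : U ⊆ W := subset_perp_perp (Set.subset_univ _)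
  -- an element of `W` killed by `U` on one side vanishes
  have hr : ∀ e ∈ W, (∀ u ∈ U, e * u = 0) → e = 0 := by
    intro e he h
    have h1 : star e * e ∈ perp Set.univ U := by
      refine ⟨trivial, fun u hu => ⟨by rw [mul_assoc, h u hu, mul_zero], ?_⟩⟩
      apply star_injective
      have := h _ (hU.star hu)
      simp [mul_assoc, this]
    exact eq_zero_of_star_mul_self
      (eq_zero_of_mem_perp hP.starClosed h1 (hW.mul (hW.star he) he))
  have hl : ∀ e ∈ W, (∀ u ∈ U, u * e = 0) → e = 0 := by
    intro e he h
    apply star_injective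
    rw [star_zero]
    refine hr _ (hW.star he) fun u hu => ?_
    apply star_injective
    simpa using h _ (hU.star hu)
  have hsub : ∀ {x y : A}, x ∈ W → y ∈ W → x - y ∈ W := fun hx hy => by
    rw [sub_eq_add_neg]; exact hW.add hx (hW.neg hy)
  -- `U` is central in `W`
  have hcen : ∀ x ∈ W, ∀ v ∈ U, x * v = v * x := by
    intro x hx v hv
    have he : x * v - v * x ∈ W := hsub (hW.mul hx (hUW hv)) (hW.mul (hUW hv) hx)
    refine sub_eq_zero.1 (hl _ he fun u hu => hr _ (hW.mul (hUW hu) he) fun u' hu' => ?_)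
    rw [mul_sub, sub_mul, sub_eq_zero]
    calc u * (x * v) * u' = u * x * (v * u') := by simp only [mul_assoc]
      _ = u * x * u' * v := by rw [hc v hv u' hu']; simp only [mul_assoc]
      _ = v * (u * x * u') := hc _ (hU.sandwich x hu hu') v hv
      _ = v * u * (x * u') := by simp only [mul_assoc]
      _ = u * (v * x) * u' := by rw [hc v hv u hu]; simp only [mul_assoc]
  intro x hx y hy
  have hUU : ∀ x ∈ W, ∀ u ∈ U, ∀ v ∈ U, u * v * x ∈ U := by
    intro x hx u hu v hv
    rw [mul_assoc, ← hcen x hx v hv, ← mul_assoc]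
    exact hU.sandwich x hu hv
  have hk : ∀ k ∈ W, (∀ v ∈ U, k * star v * v = 0) → k = 0 := by
    intro k hk h
    refine hr k hk fun u hu => ?_
    apply mul_eq_zero_of_mul_star
    simpa using h _ (hU.star hu)
  have hxy : x * y - y * x ∈ W := hsub (hW.mul hx hy) (hW.mul hy hx)
  have hprod : ∀ a ∈ U, ∀ b ∈ U, ∀ c ∈ U, ∀ d ∈ U,
      (x * y - y * x) * a * b * c * d = 0 := by
    intro a ha b hb c hc' d hd
    have hz : ∀ z ∈ W, z * (a * b * (c * d)) = a * b * (c * d) * z := fun z hz =>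
      hcen z hz _ (hU.mul (hU.mul ha hb) (hU.mul hc' hd))
    have hcd : ∀ z ∈ W, z * (c * d) = c * d * z := fun z hz => hcen z hz _ (hU.mul hc' hd)
    have hab : ∀ z ∈ W, z * (a * b) = a * b * z := fun z hz => hcen z hz _ (hU.mul ha hb)
    have h1 : a * b * (c * d) * (x * y) = a * b * x * (c * d * y) := by
      rw [mul_assoc (a * b), ← mul_assoc (c * d), ← hcd x hx]; simp only [mul_assoc]
    have h2 : c * d * y * (a * b * x) = a * b * (c * d) * (y * x) := by
      calc c * d * y * (a * b * x) = c * d * (y * (a * b)) * x := by simp only [mul_assoc]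
        _ = c * d * (a * b) * (y * x) := by rw [hab y hy]; simp only [mul_assoc]
        _ = a * b * (c * d) * (y * x) := by
          rw [hc _ (hU.mul hc' hd) _ (hU.mul ha hb)]
    have h3 : a * b * (c * d) * (x * y) = a * b * (c * d) * (y * x) := by
      rw [h1, ← h2]
      exact hc _ (hUU x hx a ha b hb) _ (hUU y hy c hc' d hd)
    calc (x * y - y * x) * a * b * c * d = (x * y - y * x) * (a * b * (c * d)) := by
          simp only [mul_assoc]
      _ = a * b * (c * d) * (x * y - y * x) := hz _ hxy
      _ = 0 := by rw [mul_sub, h3, sub_self]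
  rw [← sub_eq_zero]
  have hmem : ∀ k ∈ W, ∀ u ∈ U, k * u ∈ W := fun k hk u hu => hW.mul hk (hUW hu)
  refine hr _ hxy fun a ha => hr _ (hmem _ hxy a ha) fun b hb =>
    hr _ (hmem _ (hmem _ hxy a ha) b hb) fun c hc' =>
      hr _ (hmem _ (hmem _ (hmem _ hxy a ha) b hb) c hc') fun d hd => hprod a ha b hb c hc' d hd

end Univ

section Relative

variable [PartialOrder A] [StarOrderedRing A] {B E : Set A}

theorem mem_PAnnIn_of_absorbs (hB : IsHereditary B) (hE : E ∈ PAnnIn B) (hBE : Absorbs B E)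
    {W : Set A} : W ∈ PAnnIn E ↔ W ∈ PAnnIn B ∧ W ⊆ E := by
  have hEH := isHereditary_of_mem hB hE
  have hEB := subset_of_mem hB hE
  have key : ∀ W ⊆ E, StarClosed W → perp E (perp E W) = perp B (perp B W) := by
    intro W hWE hW
    have hP := hB.perp hW
    have hPE := hEH.perp hW
    have hsub : perp E W ⊆ perp B W := fun x hx => ⟨hEB hx.1, hx.2⟩
    refine Set.Subset.antisymm (fun x hx => ?_) (fun x hx => ⟨?_, fun s hs => hx.2 s (hsub hs)⟩)
    · have hQ := hEH.perp hPE.starClosed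
      have h1 : ∀ x ∈ perp E (perp E W), ∀ w ∈ perp B W, star w * x = 0 := by
        intro x hx w hw
        have hmid : ∀ v ∈ perp B W, star x * v * x = 0 := by
          intro v hv
          have hm : v * (x * star x) * star v ∈ perp E W :=
            ⟨(hBE _ (hBE _ (hEH.mul hx.1 (hEH.star hx.1)) v hv.1).2 _ (hB.star hv.1)).1,
              (hP.sandwich (x * star x) hv (hP.star hv)).2⟩
          have h2 := (hx.2 _ hm).2
          have h3 : star x * v * x * star (star x * v * x) = 0 := by
            have : star x * v * x * star (star x * v * x) =
                star x * (v * (x * star x) * star v * x) := by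
              simp only [star_mul, star_star, mul_assoc]
            rw [this, h2, mul_zero]
          exact eq_zero_of_mul_star_self h3
        apply eq_zero_of_star_mul_self
        have := hmid _ (hP.mul hw (hP.star hw))
        simpa [mul_assoc] using this
      refine ⟨hEB hx.1, fun w hw => ⟨?_, ?_⟩⟩
      · apply star_injective
        simpa using h1 _ (hQ.star hx) w hw
      · simpa using h1 _ hx _ (hP.star hw)
    · rw [← ((mem_PAnnIn_iff hB).1 hE).2]
      exact perp_anti (perp_anti hWE) hx
  rw [mem_PAnnIn_iff hB, mem_PAnnIn_iff hEH]
  constructor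
  · rintro ⟨h1, h2⟩
    have hWE : W ⊆ E := h2 ▸ perp_subset
    exact ⟨⟨h1, key W hWE h1 ▸ h2⟩, hWE⟩
  · rintro ⟨⟨h1, h2⟩, hWE⟩
    exact ⟨h1, (key W hWE h1).trans h2⟩

theorem isCentralAnnIn_of_absorbs (hB : IsHereditary B) (hE : E ∈ PAnnIn B)
    (hBE : Absorbs B E) {W : Set A} :
    IsCentralAnnIn E W ↔ IsCentralAnnIn B W ∧ W ⊆ E := by
  have hEH := isHereditary_of_mem hB hE
  have hEB := subset_of_mem hB hE
  rw [isCentralAnnIn_iff hB, isCentralAnnIn_iff hEH, mem_PAnnIn_of_absorbs hB hE hBE]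
  constructor
  · rintro ⟨⟨hW, hWE⟩, h⟩
    refine ⟨⟨hW, ?_⟩, hWE⟩
    have hWH := isHereditary_of_mem hB hW
    have hP := hB.perp hWH.starClosed
    have h1 : ∀ x ∈ W, ∀ b ∈ B, x * b ∈ W := by
      intro x hx b hb
      rw [← ((mem_PAnnIn_iff hB).1 hW).2]
      refine ⟨hB.mul (hEB (hWE hx)) hb, fun w hw => ⟨?_, ?_⟩⟩
      · have hm : star x * (x * b) ∈ W :=
          (h _ (hWH.star hx) _ (hBE x (hWE hx) b hb).1).1
        have h0 := (hw.2 _ hm).2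
        rw [mul_assoc]
        apply mul_eq_zero_of_star_mul
        simpa [mul_assoc] using h0
      · rw [← mul_assoc, (hw.2 x hx).1, zero_mul]
    refine fun x hx b hb => ⟨h1 x hx b hb, ?_⟩
    simpa using hWH.star (h1 _ (hWH.star hx) _ (hB.star hb))
  · rintro ⟨⟨hW, h⟩, hWE⟩
    exact ⟨⟨hW, hWE⟩, fun x hx b hb => h x hx b (hEB hb)⟩

theorem modularLat_of_absorbs (hB : IsHereditary B) (hE : E ∈ PAnnIn B) (hBE : Absorbs B E)
    (h : ModularLat (PAnnIn B)) : ModularLat (PAnnIn E) := by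
  have hiff := fun W => mem_PAnnIn_of_absorbs hB hE hBE (W := W)
  have hglb : ∀ {X Y m : Set A}, X ⊆ E → IsGLBIn (PAnnIn E) {X, Y} m →
      IsGLBIn (PAnnIn B) {X, Y} m := by
    rintro X Y m hX ⟨h1, h2, h3⟩
    refine ⟨((hiff _).1 h1).1, h2, fun U hU hUW => h3 U ((hiff _).2 ⟨hU, ?_⟩) hUW⟩
    exact (hUW X (by simp)).trans hX
  have hlub : ∀ {X Y m : Set A}, X ⊆ E → Y ⊆ E → IsLUBIn (PAnnIn E) {X, Y} m →
      IsLUBIn (PAnnIn B) {X, Y} m := by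
    rintro X Y m hX hY ⟨h1, h2, h3⟩
    refine ⟨((hiff _).1 h1).1, h2, fun U hU hUW => ?_⟩
    refine (h3 (U ∩ E) ((hiff _).2 ⟨inter_mem_PAnnIn hB hU hE, Set.inter_subset_right⟩)
      fun W hW => Set.subset_inter (hUW W hW) ?_).trans Set.inter_subset_left
    rcases hW with rfl | rfl
    · exact hX
    · exact hY
  intro X hX Y hY Z hZ hXZ m r₁ j r₂ hm hr₁ hj hr₂
  rw [hiff] at hX hY hZ
  have hmE := ((hiff _).1 hm.1).2
  have hjE := ((hiff _).1 hj.1).2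
  exact h X hX.1 Y hY.1 Z hZ.1 hXZ m r₁ j r₂ (hglb hY.2 hm) (hlub hX.2 hmE hr₁)
    (hlub hX.2 hY.2 hj) (hglb hjE hr₂)

end Relative

section Support

variable {D V : Set A}

theorem inter_perp_subset (hD : StarClosed D) : D ∩ perp Set.univ D ⊆ {0} :=
  fun _ hx => eq_zero_of_mem_perp hD hx.1 hx.2

theorem norm_le_norm_add {x y : A} (h : star x * y = 0) : ‖x‖ ≤ ‖x + y‖ := by
  have h1 : ‖x‖ * ‖x‖ ≤ ‖x‖ * ‖x + y‖ := by
    rw [← CStarRing.norm_star_mul_self, ← norm_star x]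
    calc ‖star x * x‖ = ‖star x * (x + y)‖ := by rw [mul_add, h, add_zero]
      _ ≤ _ := norm_mul_le _ _
  rcases (norm_nonneg x).eq_or_lt with h0 | h0
  · rw [← h0]; exact norm_nonneg _
  · exact le_of_mul_le_mul_left h1 h0

variable [PartialOrder A]

theorem isCentralAnn_iff : IsCentralAnn D ↔ IsCentralAnnIn Set.univ D := by
  simp only [IsCentralAnn, IsCentralAnnIn, annIn_univ, dAnnIn_univ, Set.subset_univ, true_and]

/-- The central support of `V` in the whole algebra. -/
def centralSupport (V : Set A) : Set A := ⋂₀ {D | IsCentralAnn D ∧ V ⊆ D}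

theorem subset_centralSupport (V : Set A) : V ⊆ centralSupport V :=
  fun _ hx _ hD => hD.2 hx

theorem centralSupport_subset (hD : IsCentralAnn D) (h : V ⊆ D) : centralSupport V ⊆ D :=
  Set.sInter_subset_of_mem ⟨hD, h⟩

theorem eq_zero_of_typeDecomposition {AI AII AIII : Set A}
    (h : TypeDecomposition AI AII AIII) {x : A} (h1 : x ∈ perp Set.univ AI)
    (h2 : x ∈ perp Set.univ AII) (h3 : x ∈ perp Set.univ AIII) : x = 0 := by
  have h0 := h.2.2.2.2.2.2.2.2.2.2
  have : x ∈ ({0} : Set A) := by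
    rw [← h0]
    rintro _ ⟨a, ha, b, hb, c, hc, rfl⟩
    simp [mul_add, add_mul, h1.2 a ha, h2.2 b hb, h3.2 c hc]
  exact this

theorem central_smul_mem {D : Set A} (hD : IsCentralAnn D) (c : ℂ) {x : A} (hx : x ∈ D) :
    c • x ∈ D := by
  obtain ⟨S, -, rfl, -⟩ := hD
  intro s hs
  rw [smul_mul_assoc, mul_smul_comm, ← smul_add, hx s hs, smul_zero]

theorem central_isClosed {D : Set A} (hD : IsCentralAnn D) : IsClosed D := by
  obtain ⟨S, -, rfl, -⟩ := hD
  have : Ann (Ann S) = ⋂ s ∈ Ann S, {a : A | a * s + s * a = 0} := by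
    ext; simp [Ann]
  rw [this]
  exact isClosed_biInter fun s _ => isClosed_eq (by fun_prop) continuous_const

end Support

section Central

variable [PartialOrder A] [StarOrderedRing A] {D E V : Set A}

/-- Membership in `𝒫` together with absorption: the algebraic form of centrality. -/
theorem central_iff : IsCentralAnn D ↔ D ∈ PAnnIn Set.univ ∧ Absorbs Set.univ D :=
  isCentralAnn_iff.trans (isCentralAnnIn_iff IsHereditary.univ)

theorem central_hereditary (hD : IsCentralAnn D) : IsHereditary D :=
  isHereditary_of_mem IsHereditary.univ (central_iff.1 hD).1

theorem perp_perp_of_mem (hV : V ∈ PAnnIn Set.univ) :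
    perp Set.univ (perp Set.univ V) = V :=
  ((mem_PAnnIn_iff IsHereditary.univ).1 hV).2

theorem hereditary_of_mem (hV : V ∈ PAnnIn Set.univ) : IsHereditary V :=
  isHereditary_of_mem IsHereditary.univ hV

theorem central_perp_of_absorbs {S : Set A} (hS : StarClosed S) (h : Absorbs Set.univ S) :
    IsCentralAnn (perp Set.univ S) :=
  central_iff.2 ⟨perp_mem_PAnnIn IsHereditary.univ hS (Set.subset_univ _),
    h.perp IsHereditary.univ⟩

theorem central_perp (hD : IsCentralAnn D) : IsCentralAnn (perp Set.univ D) :=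
  central_perp_of_absorbs (central_hereditary hD).starClosed (central_iff.1 hD).2

theorem central_sInter {F : Set (Set A)} (hF : ∀ D ∈ F, IsCentralAnn D) :
    IsCentralAnn (⋂₀ F) := by
  have h := sInter_inter_mem_PAnnIn IsHereditary.univ fun D hD => (central_iff.1 (hF D hD)).1
  rw [Set.univ_inter] at h
  exact central_iff.2 ⟨h, fun x hx b hb => ⟨fun D hD =>
    ((central_iff.1 (hF D hD)).2 x (hx D hD) b hb).1, fun D hD =>
    ((central_iff.1 (hF D hD)).2 x (hx D hD) b hb).2⟩⟩

theorem central_inter (hD : IsCentralAnn D) (hE : IsCentralAnn E) : IsCentralAnn (D ∩ E) := by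
  rw [← Set.sInter_pair]
  exact central_sInter (by simp [hD, hE])

theorem mem_PAnnIn_central (hD : IsCentralAnn D) {W : Set A} :
    W ∈ PAnnIn D ↔ W ∈ PAnnIn Set.univ ∧ W ⊆ D :=
  mem_PAnnIn_of_absorbs IsHereditary.univ (central_iff.1 hD).1 (central_iff.1 hD).2

theorem isCentralAnnIn_central (hD : IsCentralAnn D) {W : Set A} :
    IsCentralAnnIn D W ↔ IsCentralAnn W ∧ W ⊆ D := by
  rw [isCentralAnn_iff]
  exact isCentralAnnIn_of_absorbs IsHereditary.univ (central_iff.1 hD).1 (central_iff.1 hD).2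

theorem subset_perp_central (hV : IsHereditary V) (hD : IsCentralAnn D) (h : V ∩ D ⊆ {0}) :
    V ⊆ perp Set.univ D :=
  subset_perp_of_inter hV (central_iff.1 hD).2 (central_hereditary hD).starClosed h

theorem central_centralSupport (V : Set A) : IsCentralAnn (centralSupport V) :=
  central_sInter fun _ h => h.1

theorem isCentralSupportIn_centralSupport (hD : IsCentralAnn D) (h : V ⊆ D) :
    IsCentralSupportIn D V (centralSupport V) := by
  refine ⟨(isCentralAnnIn_central hD).2 ⟨central_centralSupport V, centralSupport_subset hD h⟩,
    subset_centralSupport V, fun W hW hVW => ?_⟩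
  exact centralSupport_subset ((isCentralAnnIn_central hD).1 hW).1 hVW

theorem inter_mem_PAnnIn_self (hV : V ∈ PAnnIn Set.univ) (hD : IsCentralAnn D) :
    V ∩ D ∈ PAnnIn V ∧ Absorbs V (V ∩ D) := by
  have hVH := hereditary_of_mem hV
  have key : ∀ D : Set A, IsCentralAnn D → perp V (V ∩ D) = V ∩ perp Set.univ D := by
    intro D hD
    have hDH := central_hereditary hD
    have hstar : StarClosed (V ∩ D) := fun x hx => ⟨hVH.star hx.1, hDH.star hx.2⟩
    refine Set.Subset.antisymm (fun x hx => ⟨hx.1, ?_⟩) fun x hx =>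
      ⟨hx.1, fun s hs => hx.2.2 s hs.2⟩
    refine subset_perp_central (hVH.perp hstar) hD (fun y hy => ?_) hx
    exact eq_zero_of_mem_perp hstar ⟨hy.1.1, hy.2⟩ hy.1
  refine ⟨(mem_PAnnIn_iff hVH).2 ⟨fun x hx => ⟨hVH.star hx.1,
    (central_hereditary hD).star hx.2⟩, ?_⟩, fun x hx b hb => ?_⟩
  · rw [key D hD, key _ (central_perp hD), perp_perp_of_mem (central_iff.1 hD).1]
  · have := (central_iff.1 hD).2 x hx.2 b trivial
    exact ⟨⟨hVH.mul hx.1 hb, this.1⟩, ⟨hVH.mul hb hx.1, this.2⟩⟩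

theorem modularLat_inter (hV : V ∈ PAnnIn Set.univ) (hD : IsCentralAnn D)
    (h : ModularLat (PAnnIn V)) : ModularLat (PAnnIn (V ∩ D)) :=
  modularLat_of_absorbs (hereditary_of_mem hV) (inter_mem_PAnnIn_self hV hD).1
    (inter_mem_PAnnIn_self hV hD).2 h

theorem inter_central_mem (hV : V ∈ PAnnIn Set.univ) (hD : IsCentralAnn D) :
    V ∩ D ∈ PAnnIn D :=
  (mem_PAnnIn_central hD).2 ⟨inter_mem_PAnnIn IsHereditary.univ hV (central_iff.1 hD).1,
    Set.inter_subset_right⟩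

theorem subset_perp_of_typeI (hE : IsCentralAnn E) (hD : IsCentralAnn D)
    (hEI : VonNeumannTypeI E) (hDA : ∀ V, IsAbelianAnnIn D V → V = {0}) :
    E ⊆ perp Set.univ D := by
  obtain ⟨V, ⟨hV, hVc⟩, -, -, hmin⟩ := hEI
  obtain ⟨hV, hVE⟩ := (mem_PAnnIn_central hE).1 hV
  have h0 : V ∩ D = {0} :=
    hDA _ ⟨inter_central_mem hV hD, fun x hx y hy => hVc x hx.1 y hy.1⟩
  have hVD := subset_perp_central (hereditary_of_mem hV) hD h0.subset
  have := hmin (E ∩ perp Set.univ D) ((isCentralAnnIn_central hE).2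
    ⟨central_inter hE (central_perp hD), Set.inter_subset_left⟩) (Set.subset_inter hVE hVD)
  exact this.trans Set.inter_subset_right

theorem subset_perp_of_locallyModular (hE : IsCentralAnn E) (hD : IsCentralAnn D)
    (hEm : LocallyModular E) (hDn : PurelyNonmodular D) : E ⊆ perp Set.univ D := by
  obtain ⟨T, Z, hT, hZ, -, -, -, hmin⟩ := hEm
  refine (hmin (E ∩ perp Set.univ D) ((mem_PAnnIn_central hE).2
    ⟨(central_iff.1 (central_inter hE (central_perp hD))).1, Set.inter_subset_left⟩) ?_).trans
    Set.inter_subset_right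
  rintro _ ⟨V, hVT, rfl⟩
  obtain ⟨hV, hVE⟩ := (mem_PAnnIn_central hE).1 (hT V hVT).1
  have h0 : V ∩ D = {0} :=
    hDn _ (inter_central_mem hV hD) (modularLat_inter hV hD (hT V hVT).2)
  have hVD := subset_perp_central (hereditary_of_mem hV) hD h0.subset
  exact (hZ V hVT).2.2 _ ((isCentralAnnIn_central hE).2
    ⟨central_inter hE (central_perp hD), Set.inter_subset_left⟩) (Set.subset_inter hVE hVD)

theorem subset_of_perp_inter {X F G : Set A} (hE : IsCentralAnn E) (hX : IsCentralAnn X)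
    (hEF : E ⊆ perp Set.univ F) (hEG : E ⊆ perp Set.univ G)
    (h : ∀ x, x ∈ perp Set.univ X → x ∈ perp Set.univ F → x ∈ perp Set.univ G → x = 0) :
    E ⊆ X := by
  rw [← perp_perp_of_mem (central_iff.1 hX).1]
  exact subset_perp_central (central_hereditary hE) (central_perp hX)
    fun x hx => h x hx.2 (hEF hx.1) (hEG hx.1)

theorem subset_of_typeDecomposition {AI AII AIII AI' AII' AIII' : Set A}
    (h : TypeDecomposition AI AII AIII) (h' : TypeDecomposition AI' AII' AIII') :
    AI ⊆ AI' ∧ AII ⊆ AII' ∧ AIII ⊆ AIII' := by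
  obtain ⟨hI, hIIa, hIIIa, hIIm, hIIIn, cI, cII, cIII, -⟩ := id h
  obtain ⟨hI', hIIa', hIIIa', hIIm', hIIIn', cI', cII', cIII', -⟩ := id h'
  refine ⟨subset_of_perp_inter cI cI' (subset_perp_of_typeI cI cII' hI hIIa')
      (subset_perp_of_typeI cI cIII' hI hIIIa') fun x => eq_zero_of_typeDecomposition h',
    subset_of_perp_inter cII cII' (subset_perp_comm (subset_perp_of_typeI cI' cII hI' hIIa))
      (subset_perp_of_locallyModular cII cIII' hIIm hIIIn')
      fun x h2 h1 h3 => eq_zero_of_typeDecomposition h' h1 h2 h3,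
    subset_of_perp_inter cIII cIII'
      (subset_perp_comm (subset_perp_of_typeI cI' cIII hI' hIIIa))
      (subset_perp_comm (subset_perp_of_locallyModular cII' cIII hIIm' hIIIn))
      fun x h3 h1 h2 => eq_zero_of_typeDecomposition h' h1 h2 h3⟩

/-- Some commutative annihilator has a central support that is orthogonal to no nonzero
commutative annihilator. -/
theorem exists_abelian_maximal : ∃ V : Set A, V ∈ PAnnIn Set.univ ∧
    (∀ x ∈ V, ∀ y ∈ V, x * y = y * x) ∧
    ∀ W ∈ PAnnIn Set.univ, (∀ x ∈ W, ∀ y ∈ W, x * y = y * x) →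
      W ⊆ perp Set.univ (centralSupport V) → W = {0} := by
  obtain ⟨V, hV⟩ := zorn_subset {U : Set A | IsHereditary U ∧ ∀ x ∈ U, ∀ y ∈ U, x * y = y * x} (by
    intro c hc hchain
    rcases c.eq_empty_or_nonempty with rfl | ⟨U₀, hU₀⟩
    · refine ⟨{0}, ⟨?_, by simp⟩, by simp⟩
      constructor <;> simp +contextual
    have hdir : ∀ {x y : A}, x ∈ ⋃₀ c → y ∈ ⋃₀ c → ∃ U ∈ c, x ∈ U ∧ y ∈ U := by
      rintro x y ⟨U, hU, hx⟩ ⟨U', hU', hy⟩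
      rcases hchain.total hU hU' with h | h
      · exact ⟨U', hU', h hx, hy⟩
      · exact ⟨U, hU, hx, h hy⟩
    refine ⟨⋃₀ c, ⟨⟨⟨U₀, hU₀, (hc hU₀).1.zero⟩, fun hx hy => ?_, ?_, ?_, fun hx hy => ?_,
      fun a hx hy => ?_⟩, fun x hx y hy => ?_⟩, fun s hs => Set.subset_sUnion_of_mem hs⟩
    · obtain ⟨U, hU, hx, hy⟩ := hdir hx hy
      exact ⟨U, hU, (hc hU).1.add hx hy⟩
    · rintro x ⟨U, hU, hx⟩
      exact ⟨U, hU, (hc hU).1.neg hx⟩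
    · rintro x ⟨U, hU, hx⟩
      exact ⟨U, hU, (hc hU).1.star hx⟩
    · obtain ⟨U, hU, hx, hy⟩ := hdir hx hy
      exact ⟨U, hU, (hc hU).1.mul hx hy⟩
    · obtain ⟨U, hU, hx, hy⟩ := hdir hx hy
      exact ⟨U, hU, (hc hU).1.sandwich a hx hy⟩
    · obtain ⟨U, hU, hx, hy⟩ := hdir hx hy
      exact (hc hU).2 x hx y hy)
  obtain ⟨hVH, hVc⟩ := hV.prop
  have hP := IsHereditary.univ.perp hVH.starClosed
  have hVpp : perp Set.univ (perp Set.univ V) = V :=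
    (hV.eq_of_subset ⟨IsHereditary.univ.perp hP.starClosed, commute_perp_perp hVH hVc⟩
      (subset_perp_perp (Set.subset_univ _))).symm
  refine ⟨V, (mem_PAnnIn_iff IsHereditary.univ).2 ⟨hVH.starClosed, hVpp⟩, hVc, ?_⟩
  intro W hW hWc hWV
  have hWH := hereditary_of_mem hW
  set C := centralSupport V
  have hC : IsCentralAnn C := central_centralSupport V
  have hVC : V ⊆ C := subset_centralSupport V
  have h1 : ∀ v ∈ V, ∀ w ∈ W, ∀ a, v * a * w = 0 ∧ w * a * v = 0 := fun v hv w hw a => by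
    have hm := (central_iff.1 hC).2 v (hVC hv) a trivial
    exact ⟨((hWV hw).2 _ hm.1).2, by rw [mul_assoc]; exact ((hWV hw).2 _ hm.2).1⟩
  have h2 : ∀ v ∈ V, ∀ w ∈ W, v * w = 0 ∧ w * v = 0 := fun v hv w hw =>
    ((hWV hw).2 v (hVC hv)).symm
  have hsum : V = {x | ∃ v ∈ V, ∃ w ∈ W, x = v + w} := by
    refine hV.eq_of_subset ⟨⟨⟨0, hVH.zero, 0, hWH.zero, by simp⟩, ?_, ?_, ?_, ?_, ?_⟩, ?_⟩
      fun v hv => ⟨v, hv, 0, hWH.zero, by simp⟩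
    · rintro _ _ ⟨v, hv, w, hw, rfl⟩ ⟨v', hv', w', hw', rfl⟩
      exact ⟨_, hVH.add hv hv', _, hWH.add hw hw', by abel⟩
    · rintro _ ⟨v, hv, w, hw, rfl⟩
      exact ⟨_, hVH.neg hv, _, hWH.neg hw, by abel⟩
    · rintro _ ⟨v, hv, w, hw, rfl⟩
      exact ⟨_, hVH.star hv, _, hWH.star hw, star_add v w⟩
    · rintro _ _ ⟨v, hv, w, hw, rfl⟩ ⟨v', hv', w', hw', rfl⟩
      refine ⟨_, hVH.mul hv hv', _, hWH.mul hw hw', ?_⟩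
      simp [add_mul, mul_add, h2 v hv w' hw', h2 v' hv' w hw]
    · rintro _ _ a ⟨v, hv, w, hw, rfl⟩ ⟨v', hv', w', hw', rfl⟩
      refine ⟨_, hVH.sandwich a hv hv', _, hWH.sandwich a hw hw', ?_⟩
      simp [add_mul, mul_add, h1 v hv w' hw', h1 v' hv' w hw]
    · rintro _ ⟨v, hv, w, hw, rfl⟩ _ ⟨v', hv', w', hw', rfl⟩
      simp [add_mul, mul_add, h2 v hv w' hw', h2 v' hv' w hw, hVc v hv v' hv',
        hWc w hw w' hw']
  refine Set.Subset.antisymm (fun w hw => ?_) (by simpa using hWH.zero)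
  have hwV : w ∈ V := by
    rw [hsum]
    exact ⟨0, hVH.zero, w, hw, by simp⟩
  exact inter_perp_subset (central_hereditary hC).starClosed ⟨hVC hwV, hWV hw⟩

/-- Below a central annihilator `D`, a maximal centrally orthogonal family of modular
annihilators generates a central annihilator with purely nonmodular complement in `D`. -/
theorem exists_locallyModular {D : Set A} (hD : IsCentralAnn D) :
    ∃ E : Set A, IsCentralAnn E ∧ E ⊆ D ∧ LocallyModular E ∧
      PurelyNonmodular (D ∩ perp Set.univ E) := by
  obtain ⟨T, hT⟩ := zorn_subset {T : Set (Set A) |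
      (∀ V ∈ T, V ∈ PAnnIn D ∧ ModularLat (PAnnIn V)) ∧
      ∀ V ∈ T, ∀ W ∈ T, V ≠ W → OrthogSets (centralSupport V) (centralSupport W)} (by
    intro c hc hchain
    refine ⟨⋃₀ c, ⟨?_, ?_⟩, fun s hs => Set.subset_sUnion_of_mem hs⟩
    · rintro V ⟨T, hT, hV⟩
      exact (hc hT).1 V hV
    · rintro V ⟨T, hT, hV⟩ W ⟨T', hT', hW⟩ hVW
      rcases hchain.total hT hT' with h | h
      · exact (hc hT').2 V (h hV) W hW hVW
      · exact (hc hT).2 V hV W (h hW) hVW)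
  obtain ⟨hTm, hTo⟩ := hT.prop
  set S : Set A := ⋃₀ (centralSupport '' T)
  have hSs : StarClosed S := by
    rintro x ⟨_, ⟨V, hV, rfl⟩, hx⟩
    exact ⟨_, ⟨V, hV, rfl⟩, (central_hereditary (central_centralSupport V)).star hx⟩
  have hSa : Absorbs Set.univ S := by
    rintro x ⟨_, ⟨V, hV, rfl⟩, hx⟩ b hb
    have := (central_iff.1 (central_centralSupport V)).2 x hx b hb
    exact ⟨⟨_, ⟨V, hV, rfl⟩, this.1⟩, ⟨_, ⟨V, hV, rfl⟩, this.2⟩⟩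
  have hPc := central_perp_of_absorbs hSs hSa
  have hE : IsCentralAnn (perp Set.univ (perp Set.univ S)) := central_perp hPc
  set E := perp Set.univ (perp Set.univ S)
  have hSE : S ⊆ E := subset_perp_perp (Set.subset_univ _)
  have hcE : ∀ V ∈ T, centralSupport V ⊆ E := fun V hV =>
    (Set.subset_sUnion_of_mem (Set.mem_image_of_mem _ hV)).trans hSE
  have hEmin : ∀ U ∈ PAnnIn Set.univ, S ⊆ U → E ⊆ U := fun U hU hSU => by
    rw [← perp_perp_of_mem hU]
    exact perp_anti (perp_anti hSU)
  have hED : E ⊆ D := by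
    refine hEmin D (central_iff.1 hD).1 ?_
    rintro x ⟨_, ⟨V, hV, rfl⟩, hx⟩
    exact centralSupport_subset hD ((mem_PAnnIn_central hD).1 (hTm V hV).1).2 hx
  refine ⟨E, hE, hED, ⟨T, centralSupport, fun V hV => ⟨?_, (hTm V hV).2⟩, fun V hV =>
    isCentralSupportIn_centralSupport hE ((subset_centralSupport V).trans (hcE V hV)), hTo,
    self_mem_PAnnIn (central_hereditary hE), ?_, fun U hU hUT => ?_⟩, fun W hW hWm => ?_⟩
  · exact (mem_PAnnIn_central hE).2 ⟨((mem_PAnnIn_central hD).1 (hTm V hV).1).1,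
      (subset_centralSupport V).trans (hcE V hV)⟩
  · rintro _ ⟨V, hV, rfl⟩
    exact hcE V hV
  · exact hEmin U ((mem_PAnnIn_central hE).1 hU).1 (Set.sUnion_subset hUT)
  · have hF := central_inter hD (central_perp hE)
    obtain ⟨hWP, hWF⟩ := (mem_PAnnIn_central hF).1 hW
    have hcW : centralSupport W ⊆ perp Set.univ E :=
      centralSupport_subset (central_perp hE) (hWF.trans Set.inter_subset_right)
    have hTW : insert W T ∈ {T : Set (Set A) |
        (∀ V ∈ T, V ∈ PAnnIn D ∧ ModularLat (PAnnIn V)) ∧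
        ∀ V ∈ T, ∀ W ∈ T, V ≠ W →
          OrthogSets (centralSupport V) (centralSupport W)} := by
      constructor
      · rintro V (rfl | hV)
        · exact ⟨(mem_PAnnIn_central hD).2 ⟨hWP, hWF.trans Set.inter_subset_left⟩, hWm⟩
        · exact hTm V hV
      · rintro V (rfl | hV) V' (rfl | hV') hne
        · exact absurd rfl hne
        · exact fun v hv w hw => ((hcW hv).2 w (hcE V' hV' hw)).1
        · exact fun v hv w hw => ((hcW hw).2 v (hcE V hV hv)).2
        · exact hTo V hV V' hV' hne
    have hWT : W ∈ T := by
      rw [hT.eq_of_subset hTW (Set.subset_insert _ _)]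
      exact Set.mem_insert _ _
    refine Set.Subset.antisymm (fun w hw => ?_) (by simpa using (hereditary_of_mem hWP).zero)
    exact inter_perp_subset (central_hereditary hE).starClosed
      ⟨hcE W hWT (subset_centralSupport W hw), (hWF hw).2⟩

theorem isClosed_sum {D E F : Set A} (hD : IsCentralAnn D) (hE : IsCentralAnn E)
    (hF : IsCentralAnn F) (hDE : D ⊆ perp Set.univ E) (hDF : D ⊆ perp Set.univ F)
    (hEF : E ⊆ perp Set.univ F) :
    IsClosed {x : A | ∃ a ∈ D, ∃ b ∈ E, ∃ c ∈ F, x = a + b + c} := by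
  have hDH := central_hereditary hD
  have hEH := central_hereditary hE
  have hFH := central_hereditary hF
  have : CompleteSpace D := (central_isClosed hD).completeSpace_coe
  have : CompleteSpace E := (central_isClosed hE).completeSpace_coe
  have : CompleteSpace F := (central_isClosed hF).completeSpace_coe
  let f : D × E × F → A := fun p => p.1 + p.2.1 + p.2.2
  have hf : AntilipschitzWith 1 f := by
    refine AntilipschitzWith.of_le_mul_dist fun p q => ?_
    have hsub : ∀ {G : Set A}, IsHereditary G → ∀ x y : G, (x : A) - y ∈ G := fun hG x y => by
      rw [sub_eq_add_neg]; exact hG.add x.2 (hG.neg y.2)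
    have ha := hsub hDH p.1 q.1
    have hb := hsub hEH p.2.1 q.2.1
    have hc := hsub hFH p.2.2 q.2.2
    rw [NNReal.coe_one, one_mul, dist_eq_norm (f p)]
    set a := (p.1 : A) - q.1
    set b := (p.2.1 : A) - q.2.1
    set c := (p.2.2 : A) - q.2.2
    have hfa : f p - f q = a + (b + c) := by simp only [f, a, b, c]; abel
    have hfb : f p - f q = b + (a + c) := by rw [hfa]; abel
    have hfc : f p - f q = c + (a + b) := by rw [hfa]; abel
    refine max_le ?_ (max_le ?_ ?_)
    · rw [Subtype.dist_eq, dist_eq_norm, hfa]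
      apply norm_le_norm_add
      rw [mul_add, ((hDE (hDH.star ha)).2 b hb).1, ((hDF (hDH.star ha)).2 c hc).1, add_zero]
    · rw [Subtype.dist_eq, dist_eq_norm, hfb]
      apply norm_le_norm_add
      rw [mul_add, ((hDE ha).2 _ (hEH.star hb)).2, ((hEF (hEH.star hb)).2 c hc).1, add_zero]
    · rw [Subtype.dist_eq, dist_eq_norm, hfc]
      apply norm_le_norm_add
      rw [mul_add, ((hDF ha).2 _ (hFH.star hc)).2, ((hEF hb).2 _ (hFH.star hc)).2, add_zero]
  have hfc : UniformContinuous f := by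
    have h1 : UniformContinuous fun p : D × E × F => (p.1 : A) :=
      uniformContinuous_subtype_val.comp uniformContinuous_fst
    have h2 : UniformContinuous fun p : D × E × F => (p.2.1 : A) :=
      uniformContinuous_subtype_val.comp (uniformContinuous_fst.comp uniformContinuous_snd)
    have h3 : UniformContinuous fun p : D × E × F => (p.2.2 : A) :=
      uniformContinuous_subtype_val.comp (uniformContinuous_snd.comp uniformContinuous_snd)
    exact (h1.add h2).add h3
  convert hf.isClosed_range hfc
  ext x
  constructor
  · rintro ⟨a, ha, b, hb, c, hc, rfl⟩
    exact ⟨(⟨a, ha⟩, ⟨b, hb⟩, ⟨c, hc⟩), rfl⟩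
  · rintro ⟨⟨a, b, c⟩, rfl⟩
    exact ⟨a, a.2, b, b.2, c, c.2, rfl⟩

theorem exists_starSubalgebra_sum {D E F : Set A} (hD : IsCentralAnn D) (hE : IsCentralAnn E)
    (hF : IsCentralAnn F) : ∃ B : NonUnitalStarSubalgebra ℂ A,
      (B : Set A) = {x : A | ∃ a ∈ D, ∃ b ∈ E, ∃ c ∈ F, x = a + b + c} := by
  have hDH := central_hereditary hD
  have hEH := central_hereditary hE
  have hFH := central_hereditary hF
  have hDA := (central_iff.1 hD).2
  have hEA := (central_iff.1 hE).2
  have hFA := (central_iff.1 hF).2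
  refine ⟨{ carrier := {x : A | ∃ a ∈ D, ∃ b ∈ E, ∃ c ∈ F, x = a + b + c}
            add_mem' := ?_
            zero_mem' := ⟨0, hDH.zero, 0, hEH.zero, 0, hFH.zero, by simp⟩
            mul_mem' := ?_
            smul_mem' := ?_
            star_mem' := ?_ }, rfl⟩
  · rintro _ _ ⟨a, ha, b, hb, c, hc, rfl⟩ ⟨a', ha', b', hb', c', hc', rfl⟩
    exact ⟨_, hDH.add ha ha', _, hEH.add hb hb', _, hFH.add hc hc', by abel⟩
  · rintro _ y ⟨a, ha, b, hb, c, hc, rfl⟩ -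
    exact ⟨_, (hDA a ha y trivial).1, _, (hEA b hb y trivial).1, _, (hFA c hc y trivial).1,
      by rw [add_mul, add_mul]⟩
  · rintro r _ ⟨a, ha, b, hb, c, hc, rfl⟩
    exact ⟨_, central_smul_mem hD r ha, _, central_smul_mem hE r hb, _,
      central_smul_mem hF r hc, by rw [smul_add, smul_add]⟩
  · rintro _ ⟨a, ha, b, hb, c, hc, rfl⟩
    exact ⟨_, hDH.star ha, _, hEH.star hb, _, hFH.star hc, by rw [star_add, star_add]⟩

theorem ann_sum {D E F : Set A} (hD : IsCentralAnn D) (hE : IsCentralAnn E)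
    (hF : IsCentralAnn F)
    (h : ∀ x, x ∈ perp Set.univ D → x ∈ perp Set.univ E → x ∈ perp Set.univ F → x = 0) :
    Ann {x : A | ∃ a ∈ D, ∃ b ∈ E, ∃ c ∈ F, x = a + b + c} = {0} := by
  have hDH := central_hereditary hD
  have hEH := central_hereditary hE
  have hFH := central_hereditary hF
  refine Set.Subset.antisymm (fun x hx => h x ?_ ?_ ?_) (by rintro _ rfl; simp [Ann])
  · rw [← annIn_eq_perp_of_isHereditary hDH]
    exact ⟨trivial, fun s hs => hx s ⟨s, hs, 0, hEH.zero, 0, hFH.zero, by simp⟩⟩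
  · rw [← annIn_eq_perp_of_isHereditary hEH]
    exact ⟨trivial, fun s hs => hx s ⟨0, hDH.zero, s, hs, 0, hFH.zero, by simp⟩⟩
  · rw [← annIn_eq_perp_of_isHereditary hFH]
    exact ⟨trivial, fun s hs => hx s ⟨0, hDH.zero, 0, hEH.zero, s, hs, by simp⟩⟩

theorem exists_typeDecomposition : ∃ AI AII AIII : Set A, TypeDecomposition AI AII AIII := by
  obtain ⟨V, hV, hVc, hVmax⟩ := exists_abelian_maximal (A := A)
  have hI : IsCentralAnn (centralSupport V) := central_centralSupport V
  have hVI := subset_centralSupport V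
  have hsupp := isCentralSupportIn_centralSupport hI hVI
  set AI := centralSupport V
  have hIp := central_perp hI
  obtain ⟨AII, hII, hIIp, hIIm, hIIIn⟩ := exists_locallyModular hIp
  have hIII := central_inter hIp (central_perp hII)
  have habel : ∀ D, IsCentralAnn D → D ⊆ perp Set.univ AI →
      ∀ W, IsAbelianAnnIn D W → W = {0} := by
    rintro D hD hDI W ⟨hW, hWc⟩
    obtain ⟨hWP, hWD⟩ := (mem_PAnnIn_central hD).1 hW
    exact hVmax W hWP hWc (hWD.trans hDI)
  refine ⟨AI, AII, perp Set.univ AI ∩ perp Set.univ AII,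
    ⟨V, ⟨(mem_PAnnIn_central hI).2 ⟨hV, hVI⟩, hVc⟩, hsupp⟩,
    habel _ hII hIIp, habel _ hIII Set.inter_subset_left, hIIm, hIIIn, hI, hII, hIII,
    exists_starSubalgebra_sum hI hII hIII, isClosed_sum hI hII hIII (subset_perp_comm hIIp)
      (subset_perp_comm Set.inter_subset_left) (subset_perp_comm Set.inter_subset_right),
    ann_sum hI hII hIII fun x h1 h2 h3 => ?_⟩
  exact inter_perp_subset (central_hereditary hIII).starClosed ⟨⟨h1, h2⟩, h3⟩

end Central

end TypeDecomp

section CStar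

variable [NonUnitalCStarAlgebra A] [PartialOrder A] [StarOrderedRing A]

/-- Every C*-algebra `A` admits unique C*-subalgebras `A_I`, `A_II`, `A_III`
satisfying (a) `A_I` is of von Neumann type I, `A_II` and `A_III` have no nonzero Abelian
annihilators, `𝒫_{A_II}` is locally modular and `𝒫_{A_III}` is purely nonmodular;
(b) all three are central annihilators of `A`; and (c) `A_I ⊕ A_II ⊕ A_III` is a
C*-subalgebra of `A` with zero annihilator. -/
theorem stmt_16 :
    ∃ AI AII AIII : Set A, TypeDecomposition AI AII AIII ∧
      ∀ AI' AII' AIII' : Set A, TypeDecomposition AI' AII' AIII' →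
        AI' = AI ∧ AII' = AII ∧ AIII' = AIII := by
  obtain ⟨AI, AII, AIII, h⟩ := TypeDecomp.exists_typeDecomposition (A := A)
  refine ⟨AI, AII, AIII, h, fun AI' AII' AIII' h' => ?_⟩
  obtain ⟨h1, h2, h3⟩ := TypeDecomp.subset_of_typeDecomposition h h'
  obtain ⟨h1', h2', h3'⟩ := TypeDecomp.subset_of_typeDecomposition h' h
  exact ⟨h1'.antisymm h1, h2'.antisymm h2, h3'.antisymm h3⟩

end CStar
end

section
/- Let A be a simple C*-algebra of type II₁, i.e. a simple C*-algebra whose lattice 𝒫 of annihilators is modular. Then A is finite: every projection in A is finite. -/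
variable {A : Type*}

/-- A projection in a *-ring. -/
def IsProjection [NonUnitalNonAssocRing A] [StarRing A] (p : A) : Prop :=
  p * p = p ∧ star p = p

/-- Murray–von Neumann equivalence of projections. -/
def MvNEquiv [NonUnitalNonAssocRing A] [StarRing A] (p q : A) : Prop :=
  ∃ x : A, x * star x = p ∧ star x * x = q

/-- A projection is infinite if it is equivalent to a proper subprojection of itself. -/
def IsInfiniteProjection [NonUnitalNonAssocRing A] [StarRing A] (p : A) : Prop :=
  ∃ q : A, IsProjection q ∧ q * p = q ∧ p * q = q ∧ q ≠ p ∧ MvNEquiv p q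

/-- `A` is simple: it has no nonzero proper closed two-sided ideals. -/
def IsSimpleCStar (A : Type*) [NonUnitalNormedRing A] : Prop :=
  ∀ I : TwoSidedIdeal A, IsClosed (I : Set A) → I = ⊥ ∨ I = ⊤

section Annihilators

variable {A : Type*} [NonUnitalCStarAlgebra A]

/-- If `a` annihilates `w * star w` from the left, then it annihilates `w`. -/
lemma mul_eq_zero_of_mul_mul_star_eq_zero {a w : A} (h : a * (w * star w) = 0) : a * w = 0 := by
  rw [← CStarRing.mul_star_self_eq_zero_iff, star_mul, mul_assoc, ← mul_assoc w, ← mul_assoc, h,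
    zero_mul]

/-- If `a` annihilates `w * star w` from the right, then it annihilates `star w`. -/
lemma star_mul_eq_zero_of_mul_star_mul_eq_zero {a w : A} (h : w * star w * a = 0) :
    star w * a = 0 := by
  have h' : star a * (w * star w) = 0 := by
    simpa [mul_assoc] using congrArg star h
  simpa using congrArg star (mul_eq_zero_of_mul_mul_star_eq_zero h')

variable [PartialOrder A] [StarOrderedRing A]

/-- An element anticommuting with a positive element annihilates it from the left. -/
lemma mul_eq_zero_of_anticommute {a s : A} (hs : 0 ≤ s) (h : a * s + s * a = 0) :
    a * s = 0 := by
  have h1 : a * s = -(s * a) := eq_neg_of_add_eq_zero_left h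
  have h2 : Commute (s * s) a := by
    change s * s * a = a * (s * s)
    rw [← mul_assoc a, h1, neg_mul, mul_assoc s a s, h1, mul_neg, neg_neg, mul_assoc]
  have h3 : Commute s a := by
    rw [← CFC.sqrt_mul_self s hs]
    exact h2.cfcₙ_nnreal _
  rw [h3.eq, ← two_smul ℂ] at h
  exact (smul_eq_zero.mp h).resolve_left two_ne_zero

/-- Annihilators of positive elements of the form `w * star w` are two-sided annihilators. -/
lemma mem_Ann_image_mul_star {S : Set A} {a : A} :
    a ∈ Ann ((fun w ↦ w * star w) '' S) ↔ ∀ w ∈ S, a * w = 0 ∧ star w * a = 0 := by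
  constructor
  · intro h w hw
    have h1 := h _ ⟨w, hw, rfl⟩
    have h2 := mul_eq_zero_of_anticommute (mul_star_self_nonneg w) h1
    exact ⟨mul_eq_zero_of_mul_mul_star_eq_zero h2,
      star_mul_eq_zero_of_mul_star_mul_eq_zero (by simpa [h2] using h1)⟩
  · rintro h _ ⟨w, hw, rfl⟩
    simp only [← mul_assoc, (h w hw).1, zero_mul, zero_add]
    rw [mul_assoc, (h w hw).2, mul_zero]

lemma star_mem_Ann_image_mul_star {S : Set A} {a : A}
    (ha : a ∈ Ann ((fun w ↦ w * star w) '' S)) :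
    star a ∈ Ann ((fun w ↦ w * star w) '' S) := by
  rw [mem_Ann_image_mul_star] at ha ⊢
  intro w hw
  exact ⟨by simpa using congrArg star (ha w hw).2, by simpa using congrArg star (ha w hw).1⟩

lemma mul_star_self_mem_Ann_image {S : Set A} {a : A}
    (ha : a ∈ Ann ((fun w ↦ w * star w) '' S)) :
    a * star a ∈ Ann ((fun w ↦ w * star w) '' S) := by
  have hb := star_mem_Ann_image_mul_star ha
  rw [mem_Ann_image_mul_star] at *
  intro w hw
  exact ⟨by rw [mul_assoc, (hb w hw).1, mul_zero], by rw [← mul_assoc, (ha w hw).2, zero_mul]⟩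

lemma Ann_image_mul_star_mem_PAnn (S : Set A) : Ann ((fun w ↦ w * star w) '' S) ∈ PAnn A := by
  refine ⟨(fun w ↦ w * star w) '' Ann ((fun w ↦ w * star w) '' S), ?_, ?_⟩
  · rintro _ ⟨w, -, rfl⟩
    exact mul_star_self_nonneg w
  · apply Set.Subset.antisymm
    · intro a ha b hb
      rw [mem_Ann_image_mul_star] at hb
      rw [(hb a ha).1, add_zero]
      simpa using (hb (star a) (star_mem_Ann_image_mul_star ha)).2
    · intro a ha s hs
      refine ha s ?_
      rintro _ ⟨w, hw, rfl⟩
      rw [add_comm]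
      exact mul_star_self_mem_Ann_image hw s hs

omit [PartialOrder A] [StarOrderedRing A] in
lemma Ann_Ann_eq_univ_of_forall {S U V : Set A} (hU : U ⊆ Ann (Ann S)) (hV : V ⊆ Ann (Ann S))
    (h : ∀ z ∈ Ann (U ∪ V), z = 0) : Ann (Ann S) = Set.univ := by
  refine Set.eq_univ_of_forall fun a c hc ↦ ?_
  have : c = 0 := by
    refine h c ?_
    rintro s (hs | hs)
    · rw [add_comm]; exact hU hs c hc
    · rw [add_comm]; exact hV hs c hc
  simp [this]

/-- If `M ⊆ L` define distinct annihilators, and `N` is such that the annihilators of `L` and `N`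
span everything while those of `M` and `N` meet inside that of `L`, then `𝒫` is not modular. -/
lemma not_modularLat_of_sets {L M N : Set A}
    (hLM : Ann ((fun w ↦ w * star w) '' L) ⊆ Ann ((fun w ↦ w * star w) '' M))
    (hne : Ann ((fun w ↦ w * star w) '' L) ≠ Ann ((fun w ↦ w * star w) '' M))
    (hmeet : Ann ((fun w ↦ w * star w) '' N) ∩ Ann ((fun w ↦ w * star w) '' M) ⊆
      Ann ((fun w ↦ w * star w) '' L))
    (hjoin : ∀ z ∈ Ann (Ann ((fun w ↦ w * star w) '' L) ∪ Ann ((fun w ↦ w * star w) '' N)),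
      z = 0) :
    ¬ ModularLat (PAnn A) := by
  intro hmod
  have hL := Ann_image_mul_star_mem_PAnn L
  have hM := Ann_image_mul_star_mem_PAnn M
  have hN := Ann_image_mul_star_mem_PAnn N
  have hm := Ann_image_mul_star_mem_PAnn (N ∪ M)
  have hinter : Ann ((fun w ↦ w * star w) '' (N ∪ M)) =
      Ann ((fun w ↦ w * star w) '' N) ∩ Ann ((fun w ↦ w * star w) '' M) := by
    ext a
    simp only [Set.mem_inter_iff, mem_Ann_image_mul_star, Set.mem_union, or_imp, forall_and]
    tauto
  have huniv : (Set.univ : Set A) ∈ PAnn A := by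
    have := Ann_image_mul_star_mem_PAnn (∅ : Set A)
    rwa [Set.image_empty, show Ann (∅ : Set A) = Set.univ from
      Set.eq_univ_of_forall fun a s hs ↦ hs.elim] at this
  rw [hinter] at hm
  refine hne (hmod _ hL _ hN _ hM hLM _ _ Set.univ _ ⟨hm, ?_, ?_⟩ ⟨hL, ?_, ?_⟩
    ⟨huniv, ?_, ?_⟩ ⟨hM, ?_, ?_⟩)
  · rintro W (rfl | rfl)
    exacts [Set.inter_subset_left, Set.inter_subset_right]
  · intro U _ h
    exact Set.subset_inter (h _ (by simp)) (h _ (by simp))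
  · rintro W (rfl | rfl)
    exacts [subset_rfl, hmeet]
  · intro U _ h
    exact h _ (by simp)
  · intro W _
    exact Set.subset_univ W
  · rintro U ⟨S, -, rfl⟩ h
    rw [Ann_Ann_eq_univ_of_forall (h _ (by simp)) (h _ (by simp)) hjoin]
  · rintro W (rfl | rfl)
    exacts [Set.subset_univ _, subset_rfl]
  · intro U _ h
    exact h _ (by simp)

omit [PartialOrder A] [StarOrderedRing A] in
lemma eq_zero_of_forall_two_pow_smul_norm_le {y : A} {C : ℝ}
    (h : ∀ n : ℕ, ‖(2 ^ n : ℂ) • y‖ ≤ C) : y = 0 := by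
  by_contra hy
  have hy' : 0 < ‖y‖ := norm_pos_iff.mpr hy
  obtain ⟨n, hn⟩ := pow_unbounded_of_one_lt (C / ‖y‖) (one_lt_two (α := ℝ))
  have := h n
  rw [norm_smul, norm_pow, Complex.norm_ofNat] at this
  rw [div_lt_iff₀ hy'] at hn
  linarith

omit [PartialOrder A] [StarOrderedRing A] in
/-- If `a` is bounded, then anything annihilating all `b n - 2 b (n + 1)` and all `4 ^ n b n - a n`
annihilates every `b n`. -/
lemma mul_eq_zero_of_relations {a b : ℕ → A} {C : ℝ} (hC : ∀ n, ‖a n‖ ≤ C) {x : A}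
    (hM : ∀ n, x * (b n - (2 : ℂ) • b (n + 1)) = 0)
    (hN : ∀ n, x * ((4 ^ n : ℂ) • b n - a n) = 0) (n : ℕ) : x * b n = 0 := by
  have h1 (n : ℕ) : x * b n = (2 : ℂ) • (x * b (n + 1)) := by
    simpa [mul_sub, sub_eq_zero, mul_smul_comm] using hM n
  have h2 (n : ℕ) : (4 ^ n : ℂ) • (x * b n) = x * a n := by
    simpa [mul_sub, sub_eq_zero, mul_smul_comm] using hN n
  have h3 (n : ℕ) : x * b 0 = (2 ^ n : ℂ) • (x * b n) := by
    induction n with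
    | zero => simp
    | succ n ih => rw [ih, h1 n, smul_smul, pow_succ]
  have h4 : x * b 0 = 0 := by
    refine eq_zero_of_forall_two_pow_smul_norm_le (C := ‖x‖ * C) fun n ↦ ?_
    rw [h3 n, smul_smul, ← mul_pow, show (2 * 2 : ℂ) = 4 by norm_num, h2]
    exact (norm_mul_le _ _).trans (mul_le_mul_of_nonneg_left (hC n) (norm_nonneg _))
  have h5 := h3 n
  rw [h4] at h5
  exact (smul_eq_zero.mp h5.symm).resolve_left (pow_ne_zero _ two_ne_zero)

/-- The existence of an infinite sequence of mutually orthogonal elements of equal nonzero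
modulus contradicts modularity. -/
lemma not_modularLat_of_orthogonal {e : A} (he : e ≠ 0) {a b : ℕ → A}
    (haa : ∀ n, star (a n) * a n = e)
    (hbb : ∀ m n, star (b m) * b n = if m = n then e else 0)
    (haa' : ∀ m n, m ≠ n → star (a m) * a n = 0)
    (hab : ∀ m n, star (a m) * b n = 0) :
    ¬ ModularLat (PAnn A) := by
  have hba (m n : ℕ) : star (b m) * a n = 0 := by
    simpa using congrArg star (hab n m)
  have hstar {w z : A} (h : star w * z = 0) : star z * w = 0 := by
    simpa using congrArg star h
  have hproj {w : A} {S : Set A} (h : ∀ z ∈ S, star w * z = 0) :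
      w * star w ∈ Ann ((fun w ↦ w * star w) '' S) := by
    rw [mem_Ann_image_mul_star]
    intro z hz
    exact ⟨by rw [mul_assoc, h z hz, mul_zero], by rw [← mul_assoc, hstar (h z hz), zero_mul]⟩
  have hnorm {w : A} (h : star w * w = e) : ‖w‖ ≤ √‖e‖ := by
    refine Real.le_sqrt_of_sq_le ?_
    rw [← h, CStarRing.norm_star_mul_self, sq]
  apply not_modularLat_of_sets (L := Set.range b)
    (M := Set.range fun n ↦ b n - (2 : ℂ) • b (n + 1))
    (N := Set.range fun n ↦ (4 ^ n : ℂ) • b n - a n)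
  · intro x hx
    rw [mem_Ann_image_mul_star] at hx ⊢
    rintro _ ⟨n, rfl⟩
    have h1 := hx _ ⟨n, rfl⟩
    have h2 := hx _ ⟨n + 1, rfl⟩
    simp [mul_sub, sub_mul, mul_smul_comm, smul_mul_assoc, h1.1, h1.2, h2.1, h2.2]
  · intro heq
    have hsum : Summable fun n ↦ ((2 : ℂ)⁻¹ ^ n) • b n := by
      refine Summable.of_norm_bounded (g := fun n ↦ (2 : ℝ)⁻¹ ^ n * √‖e‖)
        ((summable_geometric_of_lt_one (by norm_num) (by norm_num)).mul_right _) fun n ↦ ?_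
      rw [norm_smul, norm_pow, norm_inv, Complex.norm_ofNat]
      exact mul_le_mul_of_nonneg_left (hnorm (by simp [hbb])) (by positivity)
    have hη (m : ℕ) : star (b m) * ∑' n, ((2 : ℂ)⁻¹ ^ n) • b n = ((2 : ℂ)⁻¹ ^ m) • e := by
      rw [← hsum.tsum_mul_left, tsum_eq_single m]
      · simp [hbb, mul_smul_comm]
      · intro n hn
        simp [hbb, hn.symm, mul_smul_comm]
    set η := ∑' n, ((2 : ℂ)⁻¹ ^ n) • b n
    have hmem : η * star η ∈ Ann ((fun w ↦ w * star w) '' Set.range b) := by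
      rw [heq]
      refine hproj ?_
      rintro _ ⟨n, rfl⟩
      apply hstar
      simp only [star_sub, star_smul, sub_mul, smul_mul_assoc, hη, smul_smul]
      rw [sub_eq_zero, pow_succ]
      congr 1
      simp [mul_left_comm (2 : ℂ)]
    rw [mem_Ann_image_mul_star] at hmem
    have h0 := star_mul_eq_zero_of_mul_star_mul_eq_zero (hmem _ ⟨0, rfl⟩).1
    have h1 := hstar h0
    rw [hη] at h1
    simp [he] at h1
  · rintro x ⟨hxN, hxM⟩
    have key {x : A}
        (hxN : x ∈ Ann ((fun w ↦ w * star w) '' Set.range fun n ↦ (4 ^ n : ℂ) • b n - a n))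
        (hxM : x ∈ Ann ((fun w ↦ w * star w) '' Set.range fun n ↦ b n - (2 : ℂ) • b (n + 1)))
        (n : ℕ) : x * b n = 0 := by
      rw [mem_Ann_image_mul_star] at hxN hxM
      exact mul_eq_zero_of_relations (fun n ↦ hnorm (haa n)) (fun n ↦ (hxM _ ⟨n, rfl⟩).1)
        (fun n ↦ (hxN _ ⟨n, rfl⟩).1) n
    rw [mem_Ann_image_mul_star]
    rintro _ ⟨n, rfl⟩
    refine ⟨key hxN hxM n, ?_⟩
    simpa using congrArg star
      (key (star_mem_Ann_image_mul_star hxN) (star_mem_Ann_image_mul_star hxM) n)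
  · intro z hz
    have hkill {w : A} (hw : w * star w ∈ Ann ((fun w ↦ w * star w) '' Set.range b) ∪
        Ann ((fun w ↦ w * star w) '' Set.range fun n ↦ (4 ^ n : ℂ) • b n - a n)) :
        z * w = 0 ∧ star w * z = 0 := by
      have h1 := hz _ hw
      have h2 := mul_eq_zero_of_anticommute (mul_star_self_nonneg w) h1
      exact ⟨mul_eq_zero_of_mul_mul_star_eq_zero h2,
        star_mul_eq_zero_of_mul_star_mul_eq_zero (by simpa [h2] using h1)⟩
    have hza (n : ℕ) : z * a n = 0 ∧ star (a n) * z = 0 := by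
      refine hkill (Or.inl (hproj ?_))
      rintro _ ⟨m, rfl⟩
      exact hab n m
    have hzw (n : ℕ) :
        z * (b n + (4 ^ n : ℂ) • a n) = 0 ∧ star (b n + (4 ^ n : ℂ) • a n) * z = 0 := by
      refine hkill (Or.inr (hproj ?_))
      rintro _ ⟨m, rfl⟩
      rcases eq_or_ne n m with rfl | hnm
      · simp [mul_sub, add_mul, mul_smul_comm, smul_mul_assoc, hbb, hba, hab, haa]
      · simp [mul_sub, add_mul, mul_smul_comm, smul_mul_assoc, hbb, hba, hab, haa' n m hnm, hnm]
    have hzL : z ∈ Ann ((fun w ↦ w * star w) '' Set.range b) := by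
      rw [mem_Ann_image_mul_star]
      rintro _ ⟨n, rfl⟩
      have h1 := hzw n
      simpa [mul_add, add_mul, mul_smul_comm, smul_mul_assoc, hza n] using h1
    have h := mul_eq_zero_of_anticommute (mul_star_self_nonneg z)
      (hz _ (Or.inl (mul_star_self_mem_Ann_image hzL)))
    have h1 := mul_eq_zero_of_mul_mul_star_eq_zero h
    have h2 := hz _ (Or.inl (star_mem_Ann_image_mul_star hzL))
    have h3 : z * star z = 0 :=
      le_antisymm ((le_add_of_nonneg_right (star_mul_self_nonneg z)).trans h2.le)
        (mul_star_self_nonneg z)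
    exact CStarRing.mul_star_self_eq_zero_iff z |>.mp h3

/-- The orbit of `e` under left multiplication by `y`. -/
def leftOrbit (y e : A) : ℕ → A
  | 0 => e
  | n + 1 => y * leftOrbit y e n

end Annihilators

/-- A simple C*-algebra of type II₁ (i.e. whose lattice `𝒫` of annihilators is
modular) is finite: every projection in it is finite. -/
theorem stmt_18 {A : Type*} [NonUnitalCStarAlgebra A] [PartialOrder A] [StarOrderedRing A]
    (hsimple : IsSimpleCStar A) (hmod : ModularLat (PAnn A)) :
    ∀ p : A, IsProjection p → ¬IsInfiniteProjection p := by
  rintro p ⟨hpp, hps⟩ ⟨q, ⟨hqq, hqs⟩, hqp, hpq, hne, x, hxp, hxq⟩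
  have hxq' : x * q = x := by
    have h : (x * q - x) * star (x * q - x) = 0 := by
      have h1 : x * q * star x = p := by
        rw [← hxq, ← mul_assoc, mul_assoc, hxp, hpp]
      simp only [star_sub, star_mul, hqs, mul_sub, sub_mul, ← mul_assoc, h1, hxp]
      rw [mul_assoc x q q, hqq, h1, sub_self]
    exact sub_eq_zero.mp (CStarRing.mul_star_self_eq_zero_iff _ |>.mp h)
  have hxp' : x * p = x := by rw [← hxq', mul_assoc, hqp]
  have hpx : p * star x = star x := by
    simpa [hps] using congrArg star hxp'
  have hxe : x * (p - q) = 0 := by rw [mul_sub, hxp', hxq', sub_self]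
  have hes : star (p - q) = p - q := by rw [star_sub, hps, hqs]
  set e := p - q with he
  have hee : e * e = e := by
    simp only [he, mul_sub, sub_mul, hpp, hqq, hqp, hpq, sub_self, sub_zero]
  have hpv (n : ℕ) : p * leftOrbit (star x) e n = leftOrbit (star x) e n := by
    cases n with
    | zero => simp [leftOrbit, he, mul_sub, hpp, hpq]
    | succ n => rw [leftOrbit, ← mul_assoc, hpx]
  have h0 (n : ℕ) : star e * leftOrbit (star x) e (n + 1) = 0 := by
    rw [leftOrbit, ← mul_assoc, ← star_mul, hxe, star_zero, zero_mul]
  have hv (m n : ℕ) : star (leftOrbit (star x) e m) * leftOrbit (star x) e n =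
      if m = n then e else 0 := by
    induction m generalizing n with
    | zero =>
      cases n with
      | zero => simp [leftOrbit, hes, hee]
      | succ n => simpa [leftOrbit] using h0 n
    | succ m ih =>
      cases n with
      | zero => simpa [leftOrbit] using congrArg star (h0 m)
      | succ n =>
        rw [leftOrbit, leftOrbit, star_mul, star_star, mul_assoc, ← mul_assoc x, hxp, hpv, ih]
        simp
  refine not_modularLat_of_orthogonal (e := e) (sub_ne_zero.mpr hne.symm)
    (a := fun n ↦ leftOrbit (star x) e (2 * n + 1)) (b := fun n ↦ leftOrbit (star x) e (2 * n))
    (fun n ↦ ?_) (fun m n ↦ ?_) (fun m n hmn ↦ ?_) (fun m n ↦ ?_) hmod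
  · simp [hv]
  · simp [hv]
  · simp [hv, hmn]
  · rw [hv, if_neg (by lia)]
end
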